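/- Let V be a finite type, ℓ : V → ℝ, G ⊆ V, and δ ∈ ℝ. Let p be the softmax of ℓ and p̂ the softmax of the watermarked logits ℓ̂(v) = ℓ(v) + δ·1(v ∈ G). Writing p(G) = ∑_{v∈G} p(v) and p̂(G) = ∑_{v∈G} p̂(v), one has p̂(G) = e^δ·p(G) / (1 + (e^δ − 1)·p(G)), which also equals (1 + (e^δ − 1)·(1 − p(G)) / (1 + (e^δ − 1)·p(G)))·p(G). -/

import Mathlib

open scoped BigOperators

/-- The softmax distribution associated to a vector of logits. -/
noncomputable def softmax {V : Type*} [Fintype V] (l : V → ℝ) (v : V) : ℝ :=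
  Real.exp (l v) / ∑ w, Real.exp (l w)

/-- The watermarked logits: add `δ` to the logits of the tokens in the green list `G`. -/
def wmLogits {V : Type*} [DecidableEq V] (l : V → ℝ) (G : Finset V) (δ : ℝ) (v : V) : ℝ :=
  l v + if v ∈ G then δ else 0

theorem sum_softmax {V : Type*} [Fintype V] (l : V → ℝ) (G : Finset V) :
    ∑ v ∈ G, softmax l v = (∑ v ∈ G, Real.exp (l v)) / ∑ w, Real.exp (l w) := by
  simp only [softmax, Finset.sum_div]

theorem sum_exp_wmLogits_green {V : Type*} [DecidableEq V] (l : V → ℝ) (G : Finset V) (δ : ℝ) :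
    ∑ v ∈ G, Real.exp (wmLogits l G δ v) = Real.exp δ * ∑ v ∈ G, Real.exp (l v) := by
  rw [Finset.mul_sum]
  refine Finset.sum_congr rfl fun v hv => ?_
  rw [wmLogits, if_pos hv, Real.exp_add, mul_comm]

theorem sum_exp_wmLogits {V : Type*} [Fintype V] [DecidableEq V]
    (l : V → ℝ) (G : Finset V) (δ : ℝ) :
    ∑ v, Real.exp (wmLogits l G δ v) =
      (∑ v, Real.exp (l v)) + (Real.exp δ - 1) * ∑ v ∈ G, Real.exp (l v) := by
  have h_compl : ∑ v ∈ Gᶜ, Real.exp (wmLogits l G δ v) = ∑ v ∈ Gᶜ, Real.exp (l v) := by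
    refine Finset.sum_congr rfl fun v hv => ?_
    rw [wmLogits, if_neg (Finset.mem_compl.mp hv), add_zero]
  rw [← Finset.sum_add_sum_compl G, ← Finset.sum_add_sum_compl G fun v => Real.exp (l v),
    sum_exp_wmLogits_green, h_compl]
  ring

/-- **Closed form for the watermarked green-list probability.**  With
`p(G) = ∑_{v∈G} p(v)` and `p̂(G) = ∑_{v∈G} p̂(v)` we have
`p̂(G) = e^δ p(G)/(1 + (e^δ−1)p(G))
      = (1 + (e^δ−1)(1−p(G))/(1+(e^δ−1)p(G))) · p(G)`. -/
theorem watermarked_green_probability_formula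
    {V : Type*} [Fintype V] [Nonempty V] [DecidableEq V]
    (l : V → ℝ) (G : Finset V) (δ : ℝ) :
    (∑ v ∈ G, softmax (wmLogits l G δ) v) =
        Real.exp δ * (∑ v ∈ G, softmax l v) /
          (1 + (Real.exp δ - 1) * ∑ v ∈ G, softmax l v) ∧
      (∑ v ∈ G, softmax (wmLogits l G δ) v) =
        (1 + (Real.exp δ - 1) * (1 - ∑ v ∈ G, softmax l v) /
            (1 + (Real.exp δ - 1) * ∑ v ∈ G, softmax l v)) *
          ∑ v ∈ G, softmax l v := by
  have hZ : 0 < ∑ v, Real.exp (l v) :=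
    Finset.sum_pos (fun v _ => Real.exp_pos _) Finset.univ_nonempty
  have hW : 0 < ∑ v, Real.exp (wmLogits l G δ v) :=
    Finset.sum_pos (fun v _ => Real.exp_pos _) Finset.univ_nonempty
  rw [sum_exp_wmLogits] at hW
  rw [sum_softmax, sum_softmax, sum_exp_wmLogits_green, sum_exp_wmLogits]
  generalize ∑ v, Real.exp (l v) = Z at *
  generalize ∑ v ∈ G, Real.exp (l v) = A at *
  have h_denom : 1 + (Real.exp δ - 1) * (A / Z) = (Z + (Real.exp δ - 1) * A) / Z := by
    field_simp
  rw [h_denom]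
  have hZ' := hZ.ne'
  obtain ⟨W, h_W⟩ : ∃ W, W = Z + (Real.exp δ - 1) * A := ⟨_, rfl⟩
  rw [← h_W] at hW ⊢
  have hW' := hW.ne'
  constructor
  · field_simp
  · field_simp
    rw [h_W]
    ring
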